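/- Let A be an m × n real matrix with nonnegative entries, and let (W^t)_{t∈ℕ} and (H^t)_{t∈ℕ} be sequences of nonnegative m × k and k × n matrices produced by alternately applying the multiplicative updates H^{t+1}_{ij} = H^t_{ij} · ((W^t)ᵀA)_{ij} / ((W^t)ᵀW^tH^t)_{ij} and W^{t+1}_{ij} = W^t_{ij} · (A(H^{t+1})ᵀ)_{ij} / (W^tH^{t+1}(H^{t+1})ᵀ)_{ij}, where at every step all denominators are strictly positive. Then the sequence of divergences D_t = ‖A − W^tH^t‖² is non-increasing in t and converges to a limit (namely its infimum, which is ≥ 0). -/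

import Mathlib

open Matrix Filter Topology

/-- Columnwise descent of the Lee–Seung multiplicative update for least squares. -/
theorem sum_sq_sub_multiplicative_update_le {ι κ : Type*} [Fintype ι] [Fintype κ]
    (V : ι → κ → ℝ) (a : ι → ℝ) (h h' q : κ → ℝ)
    (hV : ∀ i l, 0 ≤ V i l) (hh : ∀ l, 0 ≤ h l) (hq : ∀ l, 0 < q l)
    (hq_eq : ∀ l, q l = ∑ i, V i l * ∑ l', V i l' * h l')
    (hupd : ∀ l, h' l = h l * (∑ i, V i l * a i) / q l) :
    ∑ i, (a i - ∑ l, V i l * h' l) ^ 2 ≤ ∑ i, (a i - ∑ l, V i l * h l) ^ 2 := by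
  set x : ι → ℝ := fun i => ∑ l, V i l * h l with hx
  set r : κ → ℝ := fun l => (∑ i, V i l * a i - q l) / q l with hr
  have hrq (l : κ) : r l * q l = ∑ i, V i l * (a i - x i) := by
    rw [hr, div_mul_cancel₀ _ (hq l).ne', hq_eq l]
    simp only [mul_sub, Finset.sum_sub_distrib, hx]
  have hh' (l : κ) : h' l = h l + h l * r l := by
    have := (hq l).ne'
    rw [hupd l, hr]
    field_simp
    ring
  set y : ι → ℝ := fun i => ∑ l, V i l * (h l * r l) with hy
  have hres (i : ι) : a i - ∑ l, V i l * h' l = (a i - x i) - y i := by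
    simp only [hh', mul_add, Finset.sum_add_distrib, hx, hy]
    ring
  have hcross : ∑ i, (a i - x i) * y i = ∑ l, h l * r l ^ 2 * q l := by
    simp only [hy, Finset.mul_sum]
    rw [Finset.sum_comm]
    refine Finset.sum_congr rfl fun l _ => ?_
    rw [show h l * r l ^ 2 * q l = h l * r l * (r l * q l) by ring, hrq, Finset.mul_sum]
    exact Finset.sum_congr rfl fun i _ => by ring
  have hquad : ∑ i, y i ^ 2 ≤ ∑ l, h l * r l ^ 2 * q l := by
    calc ∑ i, y i ^ 2 ≤ ∑ i, x i * ∑ l, V i l * h l * r l ^ 2 := by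
          refine Finset.sum_le_sum fun i _ => ?_
          exact Finset.sum_sq_le_sum_mul_sum_of_sq_le_mul _
            (fun l _ => mul_nonneg (hV i l) (hh l))
            (fun l _ => mul_nonneg (mul_nonneg (hV i l) (hh l)) (sq_nonneg _))
            (fun l _ => le_of_eq (by ring))
      _ = ∑ l, h l * r l ^ 2 * q l := by
          simp only [Finset.mul_sum]
          rw [Finset.sum_comm]
          refine Finset.sum_congr rfl fun l _ => ?_
          rw [hq_eq l, Finset.mul_sum]
          exact Finset.sum_congr rfl fun i _ => by simp only [hx]; ring
  have hnonneg : 0 ≤ ∑ l, h l * r l ^ 2 * q l :=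
    Finset.sum_nonneg fun l _ => mul_nonneg (mul_nonneg (hh l) (sq_nonneg _)) (hq l).le
  have hexpand : ∑ i, (a i - ∑ l, V i l * h' l) ^ 2
      = ∑ i, (a i - x i) ^ 2 - 2 * ∑ i, (a i - x i) * y i + ∑ i, y i ^ 2 := by
    rw [Finset.mul_sum, ← Finset.sum_sub_distrib, ← Finset.sum_add_distrib]
    exact Finset.sum_congr rfl fun i _ => by rw [hres]; ring
  rw [hexpand]
  linarith

/-- The multiplicative update of the right factor does not increase the squared Frobenius
distance. -/
theorem frobenius_sq_multiplicative_update_le {ι κ ν : Type*} [Fintype ι] [Fintype κ] [Fintype ν]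
    (A : Matrix ι ν ℝ) (V : Matrix ι κ ℝ) (H H' : Matrix κ ν ℝ)
    (hV : ∀ i l, 0 ≤ V i l) (hH : ∀ l j, 0 ≤ H l j) (hpos : ∀ l j, 0 < (Vᵀ * V * H) l j)
    (hupd : ∀ l j, H' l j = H l j * (Vᵀ * A) l j / (Vᵀ * V * H) l j) :
    ∑ i, ∑ j, (A i j - (V * H') i j) ^ 2 ≤ ∑ i, ∑ j, (A i j - (V * H) i j) ^ 2 := by
  rw [Finset.sum_comm, Finset.sum_comm (f := fun i j => (A i j - (V * H) i j) ^ 2)]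
  refine Finset.sum_le_sum fun j _ => ?_
  refine sum_sq_sub_multiplicative_update_le V (fun i => A i j) (fun l => H l j)
    (fun l => H' l j) (fun l => (Vᵀ * V * H) l j) hV (fun l => hH l j) (fun l => hpos l j)
    (fun l => ?_) (fun l => hupd l j)
  rw [Matrix.mul_assoc]
  rfl

/-- Along the alternating Lee–Seung multiplicative updates the divergences
`D t = ‖A - W^t H^t‖²` form a non-increasing sequence converging to its
infimum, which is nonnegative. -/
theorem nmf_alternating_updates_divergence_converges
    {m n k : ℕ}
    (A : Matrix (Fin m) (Fin n) ℝ)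
    (hA : ∀ i j, 0 ≤ A i j)
    (W : ℕ → Matrix (Fin m) (Fin k) ℝ)
    (H : ℕ → Matrix (Fin k) (Fin n) ℝ)
    (hW : ∀ t i j, 0 ≤ W t i j)
    (hH : ∀ t i j, 0 ≤ H t i j)
    (hposH : ∀ t i j, 0 < ((W t)ᵀ * W t * H t) i j)
    (hposW : ∀ t i j, 0 < (W t * H (t + 1) * (H (t + 1))ᵀ) i j)
    (hHupd : ∀ t i j,
      H (t + 1) i j = H t i j * ((W t)ᵀ * A) i j / ((W t)ᵀ * W t * H t) i j)
    (hWupd : ∀ t i j,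
      W (t + 1) i j =
        W t i j * (A * (H (t + 1))ᵀ) i j / (W t * H (t + 1) * (H (t + 1))ᵀ) i j)
    (D : ℕ → ℝ)
    (hD : ∀ t, D t = ∑ i, ∑ j, (A i j - (W t * H t) i j) ^ 2) :
    Antitone D ∧ Tendsto D atTop (𝓝 (⨅ t, D t)) ∧ 0 ≤ ⨅ t, D t := by
  have hstep (t : ℕ) : D (t + 1) ≤ D t := by
    rw [hD, hD]
    refine le_trans ?_ (frobenius_sq_multiplicative_update_le A (W t) (H t) (H (t + 1))
      (hW t) (hH t) (hposH t) (hHupd t))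
    have hden : (H (t + 1))ᵀᵀ * (H (t + 1))ᵀ * (W t)ᵀ
        = (W t * H (t + 1) * (H (t + 1))ᵀ)ᵀ := by
      simp only [transpose_mul, transpose_transpose, Matrix.mul_assoc]
    have hnum : (H (t + 1))ᵀᵀ * Aᵀ = (A * (H (t + 1))ᵀ)ᵀ := (transpose_mul _ _).symm
    have key := frobenius_sq_multiplicative_update_le Aᵀ (H (t + 1))ᵀ (W t)ᵀ (W (t + 1))ᵀ
      (fun i l => hH (t + 1) l i) (fun l j => hW t j l)
      (fun l j => by rw [hden]; exact hposW t j l)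
      (fun l j => by rw [hden, hnum]; exact hWupd t j l)
    simp only [← transpose_mul, transpose_apply] at key
    rw [Finset.sum_comm,
      Finset.sum_comm (f := fun i j => (A i j - (W t * H (t + 1)) i j) ^ 2)]
    exact key
  have hnonneg (t : ℕ) : 0 ≤ D t := by
    rw [hD]
    positivity
  have hanti : Antitone D := antitone_nat_of_succ_le hstep
  exact ⟨hanti, tendsto_atTop_ciInf hanti ⟨0, by rintro _ ⟨t, rfl⟩; exact hnonneg t⟩,
    le_ciInf hnonneg⟩
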